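/- arXiv:1412.8059 — 3 statements merged into one kernel-verified Lean document; each statement's English description precedes it below -/
import Mathlib

section
/- Let N ≥ 2, let b ∈ ℤ^N be a primitive vector (one that can be completed to a matrix in SL_N(ℤ)), and let T ⊆ 𝔾_m^N be the subtorus of codimension 1 defined by x^b = 1. There exists a constant C depending only on N and max_j |b_j| with the following property: for every homomorphism φ: 𝔾_m → 𝔾_m^N of size D whose image is contained in T (equivalently, writing φ(t) = (t^{a_1}, …, t^{a_N}), with a_1 b_1 + ⋯ + a_N b_N = 0), there exist homomorphisms ψ̃: 𝔾_m^{N−1} → 𝔾_m^N and φ̃: 𝔾_m → 𝔾_m^{N−1} such that: (1) ψ̃ is injective and ψ̃∘φ̃ = φ; (2) size(ψ̃) ≤ C and size(φ̃) ≤ C·D. -/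
/-- The size (sup-norm) `max_j |b_j|` of an integer vector. -/
def vecSize {n : ℕ} (a : Fin n → ℤ) : ℕ := Finset.univ.sup fun i => (a i).natAbs

theorem natAbs_le_vecSize {n : ℕ} (a : Fin n → ℤ) (i : Fin n) : (a i).natAbs ≤ vecSize a :=
  Finset.le_sup (f := fun i => (a i).natAbs) (Finset.mem_univ i)

theorem vecSize_le_iff {n : ℕ} (a : Fin n → ℤ) (C : ℕ) :
    vecSize a ≤ C ↔ ∀ i, (a i).natAbs ≤ C := by
  simp [vecSize]

theorem finite_setOf_vecSize_le (n β : ℕ) : {b : Fin n → ℤ | vecSize b ≤ β}.Finite := by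
  refine (Set.Finite.pi' fun _ : Fin n => Set.finite_Icc (-(β : ℤ)) β).subset fun b hb i => ?_
  have := (vecSize_le_iff b β).1 hb i
  simp only [Set.mem_Icc]
  omega

theorem natAbs_sum_mul_le {n : ℕ} (r a : Fin n → ℤ) :
    (∑ j, r j * a j).natAbs ≤ (∑ j, (r j).natAbs) * vecSize a := by
  rw [Finset.sum_mul]
  refine (Int.natAbs_sum_le _ _).trans (Finset.sum_le_sum fun j _ => ?_)
  rw [Int.natAbs_mul]
  exact Nat.mul_le_mul_left _ (natAbs_le_vecSize a j)

/-- The monomial map with exponent matrix `B` is injective if `B` has an integral left inverse. -/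
theorem injective_monomial_of_left_inverse {ι κ G : Type*} [Fintype ι] [Fintype κ] [DecidableEq κ]
    [CommGroup G] (B : Matrix ι κ ℤ) (L : Matrix κ ι ℤ) (h : L * B = 1) :
    Function.Injective (fun y : κ → G => fun i : ι => ∏ l, y l ^ B i l) := by
  refine Function.LeftInverse.injective (g := fun x k => ∏ i, x i ^ L k i) fun y => ?_
  funext k
  calc ∏ i, (∏ l, y l ^ B i l) ^ L k i
      = ∏ l, ∏ i, y l ^ (L k i * B i l) := by
        rw [Finset.prod_comm]
        refine Finset.prod_congr rfl fun i _ => ?_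
        rw [← Finset.prod_zpow]
        exact Finset.prod_congr rfl fun l _ => by rw [← zpow_mul, mul_comm]
    _ = ∏ l, y l ^ (L * B) k l := by
        refine Finset.prod_congr rfl fun l _ => ?_
        rw [Matrix.mul_apply]
        exact (map_sum (zpowersHom G (y l)).toAdditive (fun i => L k i * B i l) _).symm
    _ = y k := by
        rw [h, Finset.prod_eq_single k] <;> simp +contextual [eq_comm]

theorem exists_factorization_of_det_eq_one {n : ℕ} (M : Matrix (Fin (n + 1)) (Fin (n + 1)) ℤ)
    (hM : M.det = 1) :
    ∃ C : ℕ, ∀ a : Fin (n + 1) → ℤ, (∑ j, a j * M 0 j = 0) →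
      ∃ (bt : Fin (n + 1) → Fin n → ℤ) (θ : Fin n → ℤ),
        Function.Injective
          (fun y : Fin n → ℂˣ => fun i : Fin (n + 1) => ∏ l, y l ^ bt i l) ∧
        (∀ i, a i = ∑ l, bt i l * θ l) ∧
        (∀ i, vecSize (bt i) ≤ C) ∧ vecSize θ ≤ C * vecSize a := by
  set P := M.adjugate with hP
  have hMP : M * P = 1 := by rw [hP, Matrix.mul_adjugate, hM, one_smul]
  have hPM : P * M = 1 := by rw [hP, Matrix.adjugate_mul, hM, one_smul]
  refine ⟨(∑ i, ∑ j, (P i j).natAbs) + ∑ i, ∑ j, (M i j).natAbs, fun a ha =>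
    ⟨fun i l => P i l.succ, fun l => M.mulVec a l.succ, ?_, fun i => ?_, fun i => ?_, ?_⟩⟩
  · refine injective_monomial_of_left_inverse (P.submatrix id Fin.succ)
      (M.submatrix Fin.succ id) ?_
    rw [← Matrix.submatrix_mul _ _ _ _ _ Function.bijective_id, hMP,
      Matrix.submatrix_one _ (Fin.succ_injective n)]
  · have h0 : M.mulVec a 0 = 0 := by
      rw [← ha, Matrix.mulVec, dotProduct]
      simp_rw [mul_comm]
    have h : P.mulVec (M.mulVec a) i = a i := by
      rw [Matrix.mulVec_mulVec, hPM, Matrix.one_mulVec]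
    rw [← h, Matrix.mulVec, dotProduct, Fin.sum_univ_succ, h0, mul_zero, zero_add]
  · refine (vecSize_le_iff _ _).2 fun l => le_add_right ?_
    exact (Finset.single_le_sum (f := fun j => (P i j).natAbs) (fun _ _ => Nat.zero_le _)
      (Finset.mem_univ l.succ)).trans
      (Finset.single_le_sum (f := fun i => ∑ j, (P i j).natAbs) (fun _ _ => Nat.zero_le _)
        (Finset.mem_univ i))
  · refine (vecSize_le_iff _ _).2 fun l => (natAbs_sum_mul_le (M l.succ) a).trans ?_
    refine Nat.mul_le_mul_right _ (le_add_left ?_)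
    exact Finset.single_le_sum (f := fun i => ∑ j, (M i j).natAbs) (fun _ _ => Nat.zero_le _)
      (Finset.mem_univ l.succ)

/-- **Lemma (reduction to a codimension-one subtorus).**
Let `N ≥ 2`, let `b ∈ ℤ^N` be primitive (it can be completed to a matrix in `SL_N(ℤ)`), and let
`T ⊆ 𝔾_m^N` be the subtorus of codimension `1` defined by `x^b = 1`.  There is a constant `C`
depending only on `N` and `max_j |b_j|` such that: for every homomorphism
`φ : 𝔾_m → 𝔾_m^N`, `φ(t) = (t^{a_1}, …, t^{a_N})`, of size `D = max_j |a_j|` whose image is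
contained in `T` (equivalently `a_1 b_1 + ⋯ + a_N b_N = 0`), there are homomorphisms
`ψ̃ : 𝔾_m^{N-1} → 𝔾_m^N` (exponent vectors `b̃_i`) and `φ̃ : 𝔾_m → 𝔾_m^{N-1}` (exponent
vector `θ̃`) with `ψ̃` injective, `ψ̃ ∘ φ̃ = φ` (i.e. `a = b̃·θ̃`), `size(ψ̃) ≤ C` and
`size(φ̃) ≤ C·D`. -/
theorem factorization_through_codimension_one_subtorus
    (N : ℕ) (hN : 2 ≤ N) (β : ℕ) :
    ∃ C : ℕ, ∀ b : Fin N → ℤ,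
      vecSize b ≤ β →
      (∃ M : Matrix (Fin N) (Fin N) ℤ, M.det = 1 ∧
        ∀ j, M ⟨0, by omega⟩ j = b j) →
      ∀ a : Fin N → ℤ, (∑ j, a j * b j = 0) →
        ∃ (bt : Fin N → Fin (N - 1) → ℤ) (θ : Fin (N - 1) → ℤ),
          Function.Injective
            (fun y : Fin (N - 1) → ℂˣ => fun i : Fin N => ∏ l, y l ^ bt i l) ∧
          (∀ i, a i = ∑ l, bt i l * θ l) ∧
          (∀ i, vecSize (bt i) ≤ C) ∧ vecSize θ ≤ C * vecSize a := by
  obtain ⟨n, rfl⟩ : ∃ n, N = n + 1 := ⟨N - 1, by omega⟩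
  choose! c hc using fun M : Matrix (Fin (n + 1)) (Fin (n + 1)) ℤ =>
    exists_factorization_of_det_eq_one M
  let completes (b : Fin (n + 1) → ℤ) (M : Matrix (Fin (n + 1)) (Fin (n + 1)) ℤ) : Prop :=
    M.det = 1 ∧ ∀ j, M 0 j = b j
  have hfin := finite_setOf_vecSize_le (n + 1) β
  let m (b : Fin (n + 1) → ℤ) := Classical.epsilon (completes b)
  refine ⟨hfin.toFinset.sup fun b => c (m b), fun b hb hM a ha => ?_⟩
  obtain ⟨hdet, hrow⟩ : completes b (m b) := Classical.epsilon_spec hM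
  have hle : c (m b) ≤ hfin.toFinset.sup fun b => c (m b) :=
    Finset.le_sup (f := fun b => c (m b)) (hfin.mem_toFinset.2 hb)
  obtain ⟨bt, θ, hinj, hfac, hbt, hθ⟩ := hc (m b) hdet a (by simpa only [hrow] using ha)
  exact ⟨bt, θ, hinj, hfac, fun i => (hbt i).trans hle, hθ.trans (Nat.mul_le_mul_right _ hle)⟩
end

section
/- Let N ≥ 3. There exists a constant B_1 depending only on N with the following property: for every nonzero vector a = (a_1, …, a_N) ∈ ℤ^N with gcd(a_1, …, a_N) = 1, there exist linearly independent vectors b_1, …, b_{N−2} ∈ ℤ^N with ⟨b_i, a⟩ = 0 for i = 1, …, N−2 and ∏_{i=1}^{N−2} |b_i| ≤ B_1 · |a|^{(N−2)/(N−1)}. (Geometrically, this produces a 2-dimensional torsion coset T_2 containing a given torsion curve of degree |a|, with deg(T_2) ≤ B_1 |a|^{(N−2)/(N−1)}.) -/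
open Submodule Module in
theorem exists_greedy_linearIndependent {K E : Type*} [DivisionRing K] [AddCommGroup E] [Module K E]
    [FiniteDimensional K E] {n : ℕ} (hn : finrank K E = n + 1) (S : Set E) (q : E → ℕ) {u : E}
    (hu : u ≠ 0) (hS : span K (insert u S) = ⊤) :
    ∃ f : Fin (n + 1) → E, f 0 = u ∧ LinearIndependent K f ∧ ∀ i, i ≠ 0 → f i ∈ S ∧
      ∀ y ∈ S, y ∉ span K (f '' Set.Iio i) → q (f i) ≤ q y := by
  have hex (V : Submodule K E) : ∃ x, (∃ y ∈ S, y ∉ V) →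
      x ∈ S ∧ x ∉ V ∧ ∀ y ∈ S, y ∉ V → q x ≤ q y := by
    by_cases h : ∃ y ∈ S, y ∉ V
    · obtain ⟨x, hx, hmin⟩ := (measure q).wf.has_min {y | y ∈ S ∧ y ∉ V} h
      exact ⟨x, fun _ => ⟨hx.1, hx.2, fun y hy hyV => not_lt.1 (hmin y ⟨hy, hyV⟩)⟩⟩
    · exact ⟨0, fun h' => (h h').elim⟩
  choose c hc using hex
  let V : ℕ → Submodule K E := fun k =>
    Nat.rec (motive := fun _ => Submodule K E) (span K {u}) (fun _ W => W ⊔ span K {c W}) k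
  let g : ℕ → E := fun k => Nat.casesOn (motive := fun _ => E) k u (fun j => c (V j))
  have hV (k : ℕ) : V k = span K (Set.range fun i : Fin (k + 1) => g i) := by
    induction k with
    | zero => simp [V, g, Set.range_unique]
    | succ k ih =>
      rw [show V (k + 1) = V k ⊔ span K {g (k + 1)} from rfl, ih, ← span_union]
      congr 1
      ext x
      simp [Fin.exists_fin_succ', or_comm, eq_comm]
  have hgc (k : ℕ) (hk : k < n) : g (k + 1) ∈ S ∧ g (k + 1) ∉ V k ∧
      ∀ y ∈ S, y ∉ V k → q (g (k + 1)) ≤ q y := by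
    refine hc (V k) ?_
    by_contra! h
    have huV : u ∈ V k := by
      rw [hV]; exact subset_span ⟨0, rfl⟩
    have htop : V k = ⊤ := by
      rw [eq_top_iff, ← hS, span_le]
      exact Set.insert_subset huV h
    have := finrank_range_le_card (R := K) (fun i : Fin (k + 1) => g i)
    rw [Set.finrank, ← hV, htop, finrank_top, hn, Fintype.card_fin] at this
    omega
  have hli (k : ℕ) (hk : k ≤ n) : LinearIndependent K (fun i : Fin (k + 1) => g i) := by
    induction k with
    | zero => exact (linearIndependent_unique_iff (ι := Fin 1) (v := fun i => g i)).2 hu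
    | succ k ih =>
      rw [linearIndependent_finSucc']
      refine ⟨ih (by omega), ?_⟩
      have := (hgc k (by omega)).2.1
      rw [hV] at this
      exact this
  refine ⟨fun i => g i, rfl, hli n le_rfl, fun i hi => ?_⟩
  obtain ⟨k, rfl⟩ := Fin.exists_succ_eq.2 hi
  have hVk : V k = span K ((fun i : Fin (n + 1) => g i) '' Set.Iio k.succ) := by
    rw [hV]
    congr 1
    ext x
    constructor
    · rintro ⟨i, rfl⟩
      exact ⟨⟨i, by omega⟩, by simpa [Fin.lt_def] using Nat.le_of_lt_succ i.2, rfl⟩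
    · rintro ⟨i, hi, rfl⟩
      exact ⟨⟨i, by simpa [Fin.lt_def] using hi⟩, rfl⟩
  rw [← hVk]
  exact ⟨(hgc k k.2).1, (hgc k k.2).2.2⟩

/-- An integer vector, seen in Euclidean space. -/
noncomputable def intVec {N : ℕ} (x : Fin N → ℤ) : EuclideanSpace ℝ (Fin N) :=
  WithLp.toLp 2 fun i => (x i : ℝ)

open MeasureTheory Module in
/-- Minkowski's theorem on linear forms, for the coordinates in an orthonormal basis. -/
theorem exists_ne_zero_abs_inner_lt {N : ℕ}
    (e : OrthonormalBasis (Fin N) ℝ (EuclideanSpace ℝ (Fin N))) (c : Fin N → ℝ)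
    (hc : ∀ i, 0 < c i) (hprod : 1 < ∏ i, c i) :
    ∃ x : Fin N → ℤ, x ≠ 0 ∧ ∀ i, |inner ℝ (e i) (intVec x)| < c i := by
  let B := EuclideanSpace.basisFun (Fin N) ℝ
  let s : Set (EuclideanSpace ℝ (Fin N)) := {x | ∀ i, |inner ℝ (e i) x| < c i}
  have hs : s = (WithLp.ofLp ∘ e.repr) ⁻¹' (Set.univ.pi fun i => Set.Ioo (-c i) (c i)) := by
    ext x
    simp [s, abs_lt, OrthonormalBasis.repr_apply_apply]
  have hvol : volume s = ENNReal.ofReal (∏ i, (c i + c i)) := by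
    rw [hs, ((PiLp.volume_preserving_ofLp (Fin N)).comp
      e.measurePreserving_repr).measure_preimage
        (MeasurableSet.univ_pi fun i => measurableSet_Ioo).nullMeasurableSet, Real.volume_pi_Ioo,
      ENNReal.ofReal_prod_of_nonneg fun i _ => (add_pos (hc i) (hc i)).le]
    simp
  have hF : volume (ZSpan.fundamentalDomain B.toBasis) = 1 := by
    rw [measure_congr (ZSpan.fundamentalDomain_ae_parallelepiped B.toBasis volume)]
    simpa using B.volume_parallelepiped
  have : Countable (Submodule.span ℤ (Set.range B.toBasis)).toAddSubgroup :=
    inferInstanceAs (Countable (Submodule.span ℤ (Set.range B.toBasis)))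
  obtain ⟨x, hx0, hx⟩ := exists_ne_zero_mem_lattice_of_measure_mul_two_pow_lt_measure
    (s := s) (ZSpan.isAddFundamentalDomain' B.toBasis volume) (by intro x hx i; simpa using hx i)
    (by
      have : s = ⋂ i, {x | inner ℝ (e i) x ∈ Set.Ioo (-c i) (c i)} := by
        ext x; simp [s, abs_lt]
      rw [this]
      exact convex_iInter fun i =>
        (convex_Ioo _ _).is_linear_preimage (innerₛₗ ℝ (e i)).isLinear)
    (by
      rw [hF, hvol, one_mul, finrank_euclideanSpace_fin,
        show (2 : ENNReal) ^ N = ENNReal.ofReal (2 ^ N) by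
          rw [ENNReal.ofReal_pow zero_le_two, ENNReal.ofReal_ofNat]]
      simp_rw [← two_mul]
      rw [Finset.prod_mul_distrib, Finset.prod_const, Finset.card_univ, Fintype.card_fin]
      refine (ENNReal.ofReal_lt_ofReal_iff (by positivity)).2 ?_
      exact lt_mul_of_one_lt_right (by positivity) hprod)
  have hmem := (B.toBasis.mem_span_iff_repr_mem ℤ (x : EuclideanSpace ℝ (Fin N))).1 x.2
  choose z hz using hmem
  have hzx : intVec z = x := by
    ext i
    simpa [B, intVec] using hz i
  refine ⟨z, ?_, fun i => hzx ▸ hx i⟩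
  rintro rfl
  exact hx0 (Subtype.ext (by rw [← hzx]; ext; simp [intVec]))

theorem inner_intVec {N : ℕ} (x y : Fin N → ℤ) :
    inner ℝ (intVec x) (intVec y) = ((∑ i, x i * y i : ℤ) : ℝ) := by
  simp [intVec, PiLp.inner_apply, mul_comm]

theorem sq_norm_intVec {N : ℕ} (x : Fin N → ℤ) :
    ‖intVec x‖ ^ 2 = ((∑ i, x i ^ 2 : ℤ) : ℝ) := by
  rw [← real_inner_self_eq_norm_sq, inner_intVec]
  simp [sq]

theorem intVec_eq_zero_iff {N : ℕ} {x : Fin N → ℤ} : intVec x = 0 ↔ x = 0 := by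
  simp [intVec, funext_iff]

theorem norm_intVec_le_of_floor_le {N : ℕ} {x y : Fin N → ℤ}
    (h : ⌊‖intVec x‖ ^ 2⌋₊ ≤ ⌊‖intVec y‖ ^ 2⌋₊) : ‖intVec x‖ ≤ ‖intVec y‖ := by
  refine le_of_sq_le_sq ?_ (norm_nonneg _)
  rw [sq_norm_intVec, sq_norm_intVec] at *
  lift (∑ i, x i ^ 2) to ℕ using Finset.sum_nonneg fun i _ => sq_nonneg _ with m
  lift (∑ i, y i ^ 2) to ℕ using Finset.sum_nonneg fun i _ => sq_nonneg _ with k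
  simpa using h

/-- A nonzero integer vector and the integer vectors orthogonal to it span the whole space. -/
theorem span_insert_orthogonal_eq_top {N : ℕ} {a : Fin N → ℤ} (ha : a ≠ 0) :
    Submodule.span ℝ (insert (intVec a) (intVec '' {x | ∑ i, x i * a i = 0})) = ⊤ := by
  classical
  rw [eq_top_iff, ← (EuclideanSpace.basisFun (Fin N) ℝ).toBasis.span_eq, Submodule.span_le]
  rintro _ ⟨j, rfl⟩
  have hA : ((∑ i, a i * a i : ℤ) : ℝ) ≠ 0 := by
    rw [← inner_intVec, inner_self_ne_zero]
    exact mt intVec_eq_zero_iff.1 ha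
  let x : Fin N → ℤ := fun k => (∑ i, a i * a i) * (if k = j then 1 else 0) - a j * a k
  have hx : ∑ i, x i * a i = 0 := by
    simp only [x, sub_mul, Finset.sum_sub_distrib, mul_assoc, ← Finset.mul_sum]
    simp [mul_comm]
  have hj : (EuclideanSpace.basisFun (Fin N) ℝ).toBasis j =
      ((∑ i, a i * a i : ℤ) : ℝ)⁻¹ • (intVec x + (a j : ℝ) • intVec a) := by
    rw [eq_inv_smul_iff₀ hA]
    ext k
    simp [x, intVec]
  rw [hj]
  exact Submodule.smul_mem _ _ (Submodule.add_mem _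
    (Submodule.subset_span (Or.inr ⟨x, hx, rfl⟩))
    (Submodule.smul_mem _ _ (Submodule.subset_span (Or.inl rfl))))

/-- A weak form of Minkowski's second theorem for the lattice `a^⊥`. -/
theorem exists_orthogonal_prod_norm_le {n : ℕ} {a : Fin (n + 1) → ℤ} (ha : a ≠ 0) :
    ∃ b : Fin n → Fin (n + 1) → ℤ, LinearIndependent ℝ (fun i => intVec (b i)) ∧
      (∀ i, ∑ j, b i j * a j = 0) ∧ (Monotone fun i => ‖intVec (b i)‖) ∧
      ∏ i, ‖intVec (b i)‖ ≤ (n + 1 : ℝ) ^ n * ‖intVec a‖ := by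
  have ha' : intVec a ≠ 0 := mt intVec_eq_zero_iff.1 ha
  obtain ⟨f, hf0, hli, hf⟩ := exists_greedy_linearIndependent (n := n) (by simp)
    (intVec '' {x | ∑ i, x i * a i = 0}) (fun v => ⌊‖v‖ ^ 2⌋₊) ha'
    (span_insert_orthogonal_eq_top ha)
  choose b hb hbf using fun i : Fin n => (hf i.succ i.succ_ne_zero).1
  have hmin (i : Fin n) (y : Fin (n + 1) → ℤ) (hy : ∑ j, y j * a j = 0)
      (hy' : intVec y ∉ Submodule.span ℝ (f '' Set.Iio i.succ)) :
      ‖intVec (b i)‖ ≤ ‖intVec y‖ := by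
    refine norm_intVec_le_of_floor_le ?_
    rw [hbf]
    exact (hf i.succ i.succ_ne_zero).2 _ ⟨y, hy, rfl⟩ hy'
  have hpos (i : Fin n) : 0 < ‖intVec (b i)‖ := by
    rw [hbf]
    exact norm_pos_iff.2 (hli.ne_zero _)
  have hmono : Monotone fun i => ‖intVec (b i)‖ := by
    intro i j hij
    refine hmin i _ (hb j) ?_
    rw [hbf]
    exact hli.notMem_span_image (by simpa using hij)
  refine ⟨b, ?_, hb, hmono, ?_⟩
  · simp_rw [hbf]
    exact hli.comp _ (Fin.succ_injective n)
  by_contra! hlt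
  let e := InnerProductSpace.gramSchmidtOrthonormalBasis (𝕜 := ℝ) (by simp) f
  have he {i : Fin (n + 1)} {v : EuclideanSpace ℝ (Fin (n + 1))}
      (hv : v ∈ Submodule.span ℝ (f '' Set.Iio i)) : inner ℝ (e i) v = 0 := by
    induction hv using Submodule.span_induction with
    | mem x hx =>
      obtain ⟨j, hj, rfl⟩ := hx
      exact InnerProductSpace.gramSchmidtOrthonormalBasis_inv_triangular _ f hj
    | zero => simp
    | add x y _ _ hx hy => simp [inner_add_right, hx, hy]
    | smul c x _ hx => simp [inner_smul_right, hx]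
  have hapos : 0 < ‖intVec a‖ := norm_pos_iff.2 ha'
  let c : Fin (n + 1) → ℝ := Fin.cons ‖intVec a‖⁻¹ fun i => ‖intVec (b i)‖ / (n + 1)
  obtain ⟨x, hx0, hx⟩ := exists_ne_zero_abs_inner_lt e c
    (by
      refine Fin.cases ?_ fun i => ?_
      · simpa [c] using ha'
      · simp only [c, Fin.cons_succ]
        have := hpos i
        positivity)
    (by
      simp only [c, Fin.prod_univ_succ, Fin.cons_zero, Fin.cons_succ, Finset.prod_div_distrib,
        Finset.prod_const, Finset.card_univ, Fintype.card_fin]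
      rw [inv_mul_eq_div, div_div, one_lt_div (by positivity)]
      exact hlt)
  have hex : intVec a = (inner ℝ (e 0) (intVec a) : ℝ) • e 0 := by
    rw [← e.sum_repr' (intVec a), Fin.sum_univ_succ, Finset.sum_eq_zero, add_zero]
    · simp [inner_smul_right]
    · intro i _
      rw [he, zero_smul]
      exact Submodule.subset_span ⟨0, i.succ_pos, hf0⟩
  have hinner : |inner ℝ (intVec a) (intVec x)| < 1 := by
    have h0 : |inner ℝ (e 0) (intVec x)| < ‖intVec a‖⁻¹ := hx 0
    have hnorm : ‖intVec a‖ = |inner ℝ (e 0) (intVec a)| := by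
      conv_lhs => rw [hex]
      rw [norm_smul, e.norm_eq_one, mul_one, Real.norm_eq_abs]
    rw [hex, real_inner_smul_left, abs_mul, ← hnorm, mul_comm]
    rwa [← one_div, lt_div_iff₀ hapos] at h0
  have hxa : ∑ j, x j * a j = 0 := by
    rw [real_inner_comm, inner_intVec, ← Int.cast_abs] at hinner
    exact Int.abs_lt_one_iff.1 (by exact_mod_cast hinner)
  have hex0 : inner ℝ (e 0) (intVec x) = 0 := by
    have h : inner ℝ (intVec a) (intVec x) = 0 := by
      rw [real_inner_comm, inner_intVec, hxa, Int.cast_zero]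
    rw [hex, real_inner_smul_left, mul_eq_zero] at h
    refine h.resolve_left fun h0 => ha' ?_
    rw [hex, h0, zero_smul]
  obtain ⟨i, hi, hmax⟩ := Set.exists_max_image {i | inner ℝ (e i) (intVec x) ≠ 0} id
    (Set.toFinite _) (by
      by_contra! h
      have hzero (i) : inner ℝ (e i) (intVec x) = 0 := by
        simpa using Set.eq_empty_iff_forall_notMem.1 h i
      have hsum := e.sum_sq_norm_inner_right (intVec x)
      simp only [hzero, norm_zero] at hsum
      exact hx0 (intVec_eq_zero_iff.1 (by simpa using hsum.symm)))
  obtain ⟨k, rfl⟩ := Fin.exists_succ_eq.2 (show i ≠ 0 by rintro rfl; exact hi hex0)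
  have hle : ‖intVec (b k)‖ ≤ ‖intVec x‖ := hmin k x hxa fun h => hi (he h)
  have hn : (0 : ℝ) < n := Nat.cast_pos.2 k.pos
  have hcoord (i : Fin (n + 1)) :
      ‖inner ℝ (e i) (intVec x)‖ ^ 2 ≤ (‖intVec (b k)‖ / (n + 1)) ^ 2 := by
    by_cases hi0 : inner ℝ (e i) (intVec x) = 0
    · rw [hi0]
      simpa using by positivity
    obtain ⟨j, rfl⟩ := Fin.exists_succ_eq.2 (show i ≠ 0 by rintro rfl; exact hi0 hex0)
    have hjk : j ≤ k := Fin.succ_le_succ_iff.1 (hmax _ hi0)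
    have h1 : ‖inner ℝ (e j.succ) (intVec x)‖ ≤ ‖intVec (b j)‖ / (n + 1) := (hx j.succ).le
    have h2 : ‖intVec (b j)‖ ≤ ‖intVec (b k)‖ := hmono hjk
    gcongr
    exact h1.trans (by gcongr)
  have hsum := Finset.sum_le_sum fun i (_ : i ∈ Finset.univ) => hcoord i
  rw [e.sum_sq_norm_inner_right, Finset.sum_const, Finset.card_univ, Fintype.card_fin,
    nsmul_eq_mul, div_pow] at hsum
  have hlt' : ((n + 1 : ℕ) : ℝ) * (‖intVec (b k)‖ ^ 2 / (n + 1) ^ 2) < ‖intVec (b k)‖ ^ 2 := by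
    have := pow_pos (hpos k) 2
    push_cast
    rw [mul_div_assoc', div_lt_iff₀ (by positivity)]
    nlinarith [mul_pos this hn]
  exact absurd (pow_le_pow_left₀ (norm_nonneg _) hle 2) (not_le.2 (hsum.trans_lt hlt'))

theorem vecSize_le_norm_intVec {N : ℕ} (x : Fin N → ℤ) : (vecSize x : ℝ) ≤ ‖intVec x‖ := by
  suffices vecSize x ≤ ⌊‖intVec x‖⌋₊ from (Nat.le_floor_iff (norm_nonneg _)).1 this
  refine Finset.sup_le fun i _ => Nat.le_floor ?_
  simpa [intVec, Nat.cast_natAbs] using PiLp.norm_apply_le (intVec x) i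

theorem norm_intVec_le_mul_vecSize {N : ℕ} (x : Fin N → ℤ) :
    ‖intVec x‖ ≤ N * (vecSize x : ℝ) := by
  refine le_of_sq_le_sq ?_ (by positivity)
  have hcoord (i : Fin N) : ‖intVec x i‖ ^ 2 ≤ (vecSize x : ℝ) ^ 2 := by
    have h : (x i).natAbs ≤ vecSize x :=
      Finset.le_sup (f := fun i => (x i).natAbs) (Finset.mem_univ i)
    gcongr
    simpa [intVec, Nat.cast_natAbs] using (Nat.cast_le (α := ℝ)).2 h
  rw [EuclideanSpace.norm_sq_eq, mul_pow]
  refine (Finset.sum_le_sum fun i _ => hcoord i).trans ?_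
  rw [Finset.sum_const, Finset.card_univ, Fintype.card_fin, nsmul_eq_mul]
  gcongr
  exact_mod_cast Nat.le_self_pow two_ne_zero N

/-- Dropping the largest of `m + 1` factors of a product. -/
theorem prod_castSucc_le_rpow {m : ℕ} {r : Fin (m + 1) → ℝ} (hr : ∀ i, 0 ≤ r i)
    (hmono : Monotone r) {C : ℝ} (hC : ∏ i, r i ≤ C) :
    ∏ i : Fin m, r i.castSucc ≤ C ^ ((m : ℝ) / (m + 1)) := by
  set P := ∏ i : Fin m, r i.castSucc
  have hP : 0 ≤ P := Finset.prod_nonneg fun i _ => hr _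
  have hPl : P ≤ r (Fin.last m) ^ m := by
    simpa using Finset.prod_le_prod (s := Finset.univ) (fun i _ => hr (Fin.castSucc i))
      fun i _ => hmono (Fin.le_last i.castSucc)
  rw [Fin.prod_univ_castSucc] at hC
  have hpow : P ^ (m + 1) ≤ C ^ m := calc
    P ^ (m + 1) = P ^ m * P := pow_succ _ _
    _ ≤ P ^ m * r (Fin.last m) ^ m := by gcongr
    _ = (P * r (Fin.last m)) ^ m := (mul_pow _ _ _).symm
    _ ≤ C ^ m := by
      have := hr (Fin.last m)
      gcongr
  have hC0 : 0 ≤ C := (mul_nonneg hP (hr _)).trans hC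
  refine le_of_pow_le_pow_left₀ m.succ_ne_zero (Real.rpow_nonneg hC0 _) (hpow.trans_eq ?_)
  rw [← Real.rpow_natCast, ← Real.rpow_natCast, ← Real.rpow_mul hC0]
  congr 1
  push_cast
  field_simp

theorem LinearIndependent.intCast_of_intVec {N : ℕ} {ι : Type*} {b : ι → Fin N → ℤ}
    (h : LinearIndependent ℝ fun i => intVec (b i)) :
    LinearIndependent ℚ fun i j => (b i j : ℚ) := by
  rw [linearIndependent_iff'] at h ⊢
  intro s g hg i hi
  have := h s (fun i => (g i : ℝ)) (by
    ext j
    have := congrArg (Rat.cast : ℚ → ℝ) (congrFun hg j)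
    simpa [intVec] using this) i hi
  exact_mod_cast this

/-- **Lemma (geometry of numbers).**  Let `N ≥ 3`.  There is a constant `B_1 = B_1(N)` such
that for every nonzero `a ∈ ℤ^N` with `gcd(a_1, …, a_N) = 1` there are linearly independent
(over `ℚ`) vectors `b_1, …, b_{N-2} ∈ ℤ^N` with `⟨b_i, a⟩ = 0` for all `i` and
`∏_i |b_i| ≤ B_1 · |a|^{(N-2)/(N-1)}`.  (Geometrically: a torsion curve of degree `|a|` is
contained in a `2`-dimensional torsion coset `T_2` with `deg T_2 ≤ B_1 |a|^{(N-2)/(N-1)}`.) -/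
theorem exists_small_orthogonal_sublattice (N : ℕ) (hN : 3 ≤ N) :
    ∃ B₁ : ℝ, ∀ a : Fin N → ℤ, a ≠ 0 → Finset.univ.gcd a = 1 →
      ∃ b : Fin (N - 2) → Fin N → ℤ,
        LinearIndependent ℚ (fun i => fun j => ((b i j : ℚ))) ∧
        (∀ i, ∑ j, b i j * a j = 0) ∧
        (∏ i, (vecSize (b i) : ℝ)) ≤ B₁ * (vecSize a : ℝ) ^ (((N : ℝ) - 2) / ((N : ℝ) - 1)) := by
  obtain ⟨m, rfl⟩ : ∃ m, N = m + 2 := ⟨N - 2, by omega⟩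
  rw [Nat.add_sub_cancel]
  refine ⟨((m + 2 : ℝ) ^ (m + 2)) ^ ((m : ℝ) / (m + 1)), fun a ha _ => ?_⟩
  obtain ⟨b, hli, hb, hmono, hprod⟩ := exists_orthogonal_prod_norm_le ha
  refine ⟨fun i => b i.castSucc,
    (hli.comp _ (Fin.castSucc_injective m)).intCast_of_intVec, fun i => hb _, ?_⟩
  have hexp : (((m + 2 : ℕ) : ℝ) - 2) / (((m + 2 : ℕ) : ℝ) - 1) = (m : ℝ) / (m + 1) := by
    push_cast
    congr 1 <;> ring
  rw [hexp, ← Real.mul_rpow (by positivity) (by positivity)]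
  refine (Finset.prod_le_prod (fun i _ => by positivity)
    fun i _ => vecSize_le_norm_intVec _).trans
      (prod_castSucc_le_rpow (fun i => norm_nonneg (intVec (b i))) hmono (hprod.trans ?_))
  calc ((m + 1 : ℕ) + 1 : ℝ) ^ (m + 1) * ‖intVec a‖
      ≤ ((m + 1 : ℕ) + 1 : ℝ) ^ (m + 1) * ((m + 2 : ℕ) * (vecSize a : ℝ)) := by
        gcongr
        exact norm_intVec_le_mul_vecSize a
    _ = (m + 2 : ℝ) ^ (m + 2) * (vecSize a : ℝ) := by
        push_cast
        ring
end

section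
/- Let N ≥ 2 and let a_0, a_1, …, a_N be pairwise distinct integers with a_0 = 0. Let A(t) be the (N+1)×N matrix with entries in ℚ[t^{±1}] whose i-th row (i = 0, …, N) is (1, a_i, a_i^2, …, a_i^{N−2}, t^{a_i}). Then every N×N minor of A(t), regarded as a Laurent polynomial in t, is divisible by (t−1)^{N−1}. Equivalently, the linear subspace X of ℙ^N defined by rank A(a, (x_0:⋯:x_N)) < N (which has codimension 2) is the osculating (N−2)-dimensional linear space at the point (1 : 1 : ⋯ : 1) of the curve t ↦ (1 : t^{a_1} : ⋯ : t^{a_N}). -/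
open LaurentPolynomial

/-- An integer binomial coefficient with fixed lower entry `k` is a rational polynomial of degree
at most `k` in the upper entry. -/
theorem exists_polynomial_eval_eq_choose (k : ℕ) :
    ∃ q : Polynomial ℚ, q.natDegree ≤ k ∧ ∀ a : ℤ, q.eval (a : ℚ) = Ring.choose (a : ℚ) k := by
  refine ⟨Polynomial.C ((k.factorial : ℚ)⁻¹) * descPochhammer ℚ k, ?_, fun a => ?_⟩
  · exact (Polynomial.natDegree_C_mul_le _ _).trans (descPochhammer_natDegree ℚ k).le
  · rw [Ring.choose_eq_smul, Polynomial.eval_mul, Polynomial.eval_C, smul_eq_mul,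
      ← descPochhammer_map (algebraMap ℤ ℚ), Polynomial.eval_map_algebraMap,
      Polynomial.aeval_eq_smeval]

/-- The truncated binomial expansion of `T a` around `1`. -/
theorem T_one_sub_one_pow_dvd_T_sub_sum_choose (M : ℕ) (a : ℤ) :
    (T 1 - 1 : LaurentPolynomial ℚ) ^ M ∣
      T a - ∑ k ∈ Finset.range M, C (Ring.choose (a : ℚ) k) * (T 1 - 1) ^ k := by
  obtain _ | m := M
  · simp
  have step (b : ℤ) :
      T (b + 1) - ∑ k ∈ Finset.range (m + 1),
          C (Ring.choose ((b + 1 : ℤ) : ℚ) k) * (T 1 - 1 : LaurentPolynomial ℚ) ^ k =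
        T 1 * (T b - ∑ k ∈ Finset.range (m + 1),
          C (Ring.choose (b : ℚ) k) * (T 1 - 1) ^ k) +
        (T 1 - 1) ^ (m + 1) * C (Ring.choose (b : ℚ) m) := by
    have key : ∀ n : ℕ, ∑ k ∈ Finset.range (n + 1),
          C (Ring.choose ((b + 1 : ℤ) : ℚ) k) * (T 1 - 1 : LaurentPolynomial ℚ) ^ k =
        T 1 * ∑ k ∈ Finset.range (n + 1), C (Ring.choose (b : ℚ) k) * (T 1 - 1) ^ k -
          (T 1 - 1) ^ (n + 1) * C (Ring.choose (b : ℚ) n) := by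
      intro n
      induction n with
      | zero => simp
      | succ n ih =>
        rw [Finset.sum_range_succ, ih, Finset.sum_range_succ _ (n + 1), Int.cast_add, Int.cast_one,
          Ring.choose_succ_succ, map_add]
        ring
    rw [key, T_add]
    ring
  have hT : IsUnit (T 1 : LaurentPolynomial ℚ) := isUnit_T 1
  have iff_step (b : ℤ) := congrArg ((T 1 - 1 : LaurentPolynomial ℚ) ^ (m + 1) ∣ ·) (step b)
  simp only [dvd_add_left (dvd_mul_right _ _), hT.dvd_mul_left] at iff_step
  induction a with
  | zero => simp [Finset.sum_range_succ', Ring.choose_zero_succ]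
  | succ i ih => exact (iff_step i).mpr ih
  | pred i ih =>
    refine (iff_step (-i - 1)).mp ?_
    rwa [sub_add_cancel]

/-- Modulo `(T 1 - 1) ^ M`, the monomial `T a` is a polynomial of degree less than `M` in `a`. -/
theorem exists_T_one_sub_one_pow_dvd_T_sub_sum (M : ℕ) :
    ∃ c : ℕ → LaurentPolynomial ℚ, ∀ a : ℤ, (T 1 - 1 : LaurentPolynomial ℚ) ^ M ∣
      T a - ∑ j ∈ Finset.range M, c j * C ((a : ℚ) ^ j) := by
  choose q hdeg hq using exists_polynomial_eval_eq_choose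
  refine ⟨fun j => ∑ k ∈ Finset.range M, C ((q k).coeff j) * (T 1 - 1) ^ k, fun a => ?_⟩
  convert T_one_sub_one_pow_dvd_T_sub_sum_choose M a using 2
  simp only [Finset.sum_mul]
  rw [Finset.sum_comm]
  refine Finset.sum_congr rfl fun k hk => ?_
  rw [← hq, Polynomial.eval_eq_sum_range' ((hdeg k).trans_lt (Finset.mem_range.mp hk)), map_sum,
    Finset.sum_mul]
  refine Finset.sum_congr rfl fun j _ => ?_
  rw [map_mul]
  ring

/-- If a linear combination of the columns of `A` in which column `j` has coefficient `1` is
divisible by `d`, then so is `A.det`. -/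
theorem Matrix.dvd_det_of_dvd_sum_col {n R : Type*} [Fintype n] [DecidableEq n] [CommRing R]
    (A : Matrix n n R) (d : R) (j : n) (c : n → R) (hc : c j = 1)
    (h : ∀ r, d ∣ ∑ i, c i * A r i) : d ∣ A.det := by
  choose g hg using h
  have hdet := A.det_updateCol_sum j c
  have hcol : (fun r => ∑ i, c i • A r i) = d • g := funext hg
  rw [hcol, Matrix.det_updateCol_smul, hc, one_smul] at hdet
  exact hdet ▸ dvd_mul_right _ _

/-- **Lemma (osculating space).**  Let `N ≥ 2` and let `a_0 = 0, a_1, …, a_N` be pairwise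
distinct integers.  Let `A(t)` be the `(N+1) × N` matrix over `ℚ[t^{±1}]` whose `i`-th row is
`(1, a_i, a_i², …, a_i^{N-2}, t^{a_i})`.  Then every `N × N` minor of `A(t)` (obtained by
deleting one row) is divisible by `(t - 1)^{N-1}` in `ℚ[t^{±1}]`; equivalently, the linear
subspace of `ℙ^N` defined by `rank A(a, (x_0 : ⋯ : x_N)) < N` is the osculating
`(N-2)`-dimensional linear space of the curve `t ↦ (1 : t^{a_1} : ⋯ : t^{a_N})` at the point
`(1 : 1 : ⋯ : 1)`. -/
theorem osculating_minors_divisible (N : ℕ) (hN : 2 ≤ N) (a : Fin (N + 1) → ℤ)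
    (ha0 : a 0 = 0) (ha : Function.Injective a) :
    ∀ i : Fin (N + 1),
      ((T 1 - 1 : LaurentPolynomial ℚ)) ^ (N - 1) ∣
        Matrix.det
          (Matrix.submatrix
            (fun r j => if (j : ℕ) < N - 1 then C ((a r : ℚ) ^ (j : ℕ)) else T (a r) :
              Matrix (Fin (N + 1)) (Fin N) (LaurentPolynomial ℚ))
            i.succAbove id) := by
  intro i
  obtain ⟨M, rfl⟩ : ∃ M, N = M + 1 := ⟨N - 1, by omega⟩
  obtain ⟨c, hc⟩ := exists_T_one_sub_one_pow_dvd_T_sub_sum M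
  refine Matrix.dvd_det_of_dvd_sum_col _ _ (Fin.last M)
    (fun j => if (j : ℕ) < M then -c j else 1) (by simp) fun r => ?_
  refine (hc (a (i.succAbove r))).trans (dvd_of_eq ?_)
  rw [Fin.sum_univ_castSucc, Finset.sum_range]
  simp [Matrix.submatrix]
  ring
end
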